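/- For every τ > 0, σ > 0 and x ∈ ℝ, the strike derivative of the third spot-derivative of the Bachelier price, evaluated at the money, satisfies ∂/∂k [∂³Bac/∂x³ (τ, x, k, σ)] evaluated at k = x equals 1/(√(2π)·σ³·τ^{3/2}). -/

import Mathlib

open MeasureTheory Filter Set

/-- Standard normal density `φ(z) = e^{-z²/2}/√(2π)`. -/
noncomputable def stdGaussPdf (z : ℝ) : ℝ := Real.exp (-(z ^ 2) / 2) / Real.sqrt (2 * Real.pi)

/-- Standard normal cumulative distribution function `Φ(z) = ∫_{-∞}^z φ(u) du`. -/
noncomputable def stdGaussCdf (z : ℝ) : ℝ := ∫ u in Set.Iic z, stdGaussPdf u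

/-- `d(x, k, σ, τ) = (x − k)/(σ√τ)`. -/
noncomputable def dBac (x k σ τ : ℝ) : ℝ := (x - k) / (σ * Real.sqrt τ)

/-- Bachelier price `Bac(τ, x, k, σ) = (x − k)·Φ(d) + φ(d)·σ·√τ`. -/
noncomputable def Bac (τ x k σ : ℝ) : ℝ :=
  (x - k) * stdGaussCdf (dBac x k σ τ) + stdGaussPdf (dBac x k σ τ) * σ * Real.sqrt τ

lemma stdGaussPdf_continuous : Continuous stdGaussPdf := by
  unfold stdGaussPdf
  fun_prop

lemma stdGaussPdf_integrable : Integrable stdGaussPdf := by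
  have h := (integrable_exp_neg_mul_sq (b := 1 / 2) (by norm_num)).div_const
    (Real.sqrt (2 * Real.pi))
  refine h.congr (Filter.Eventually.of_forall fun u => ?_)
  simp only [stdGaussPdf]
  congr 2
  ring

lemma stdGaussCdf_hasDerivAt (z : ℝ) : HasDerivAt stdGaussCdf (stdGaussPdf z) z := by
  have h1 : stdGaussCdf = fun z => stdGaussCdf 0 + ∫ u in (0 : ℝ)..z, stdGaussPdf u := by
    funext w
    have := intervalIntegral.integral_Iic_sub_Iic (μ := volume) (f := stdGaussPdf) (a := 0) (b := w)
      stdGaussPdf_integrable.integrableOn stdGaussPdf_integrable.integrableOn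
    rw [← this]
    simp only [stdGaussCdf]
    ring
  rw [h1]
  exact (stdGaussPdf_continuous.integral_hasStrictDerivAt 0 z).hasDerivAt.const_add _

lemma stdGaussPdf_hasDerivAt (z : ℝ) : HasDerivAt stdGaussPdf (-z * stdGaussPdf z) z := by
  have h : HasDerivAt (fun z : ℝ => -(z ^ 2) / 2) (-z) z := by
    have := ((hasDerivAt_pow 2 z).neg).div_const 2
    refine this.congr_deriv ?_
    norm_num
    ring
  have := h.exp.div_const (Real.sqrt (2 * Real.pi))
  refine HasDerivAt.congr_deriv (f := stdGaussPdf) this ?_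
  simp only [stdGaussPdf]
  ring

lemma iteratedDeriv_three_Bac (τ σ k : ℝ) (hτ : 0 < τ) (hσ : 0 < σ) (x : ℝ) :
    iteratedDeriv 3 (fun y => Bac τ y k σ) x =
      -((x - k) / (σ * Real.sqrt τ)) * stdGaussPdf ((x - k) / (σ * Real.sqrt τ))
        / (σ * Real.sqrt τ) ^ 2 := by
  have hs : 0 < Real.sqrt τ := Real.sqrt_pos.2 hτ
  have hd : ∀ y, HasDerivAt (fun y => (y - k) / (σ * Real.sqrt τ)) (1 / (σ * Real.sqrt τ)) y :=
    fun y => ((hasDerivAt_id y).sub_const k).div_const _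
  have e1 : deriv (fun y => Bac τ y k σ) =
      fun y => stdGaussCdf ((y - k) / (σ * Real.sqrt τ)) := by
    funext y
    have a := ((hasDerivAt_id y).sub_const k).mul ((stdGaussCdf_hasDerivAt _).comp y (hd y))
    have b := (((stdGaussPdf_hasDerivAt _).comp y (hd y)).mul_const σ).mul_const (Real.sqrt τ)
    have c := (a.add b).deriv
    refine Eq.trans ?_ (c.trans ?_)
    · rfl
    · simp only [Function.comp, id]
      field_simp
      ring
  have e2 : deriv (fun y => stdGaussCdf ((y - k) / (σ * Real.sqrt τ))) =
      fun y => stdGaussPdf ((y - k) / (σ * Real.sqrt τ)) * (1 / (σ * Real.sqrt τ)) := by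
    funext y
    exact ((stdGaussCdf_hasDerivAt _).comp y (hd y)).deriv
  rw [iteratedDeriv_succ', iteratedDeriv_succ', iteratedDeriv_one, e1, e2]
  refine ((((stdGaussPdf_hasDerivAt _).comp x (hd x)).mul_const _).deriv).trans ?_
  field_simp

/-- For every τ > 0, σ > 0 and x ∈ ℝ, the strike derivative of the
third spot-derivative of the Bachelier price, evaluated at the money k = x,
equals `1/(√(2π)·σ³·τ^{3/2})`. -/
theorem bachelier_skew_greek_atm (τ σ x : ℝ) (hτ : 0 < τ) (hσ : 0 < σ) :
    deriv (fun k => iteratedDeriv 3 (fun y => Bac τ y k σ) x) x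
      = 1 / (Real.sqrt (2 * Real.pi) * σ ^ 3 * τ ^ ((3 : ℝ) / 2)) := by
  have hs : 0 < Real.sqrt τ := Real.sqrt_pos.2 hτ
  have hp : 0 < Real.sqrt (2 * Real.pi) := Real.sqrt_pos.2 (by positivity)
  have hd : HasDerivAt (fun k => (x - k) / (σ * Real.sqrt τ)) (-1 / (σ * Real.sqrt τ)) x :=
    ((hasDerivAt_id x).const_sub x).div_const _
  have e : (fun k => iteratedDeriv 3 (fun y => Bac τ y k σ) x) = fun k =>
      -((x - k) / (σ * Real.sqrt τ)) * stdGaussPdf ((x - k) / (σ * Real.sqrt τ))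
        / (σ * Real.sqrt τ) ^ 2 := by
    funext k
    exact iteratedDeriv_three_Bac τ σ k hτ hσ x
  have ht : τ ^ ((3 : ℝ) / 2) = Real.sqrt τ ^ 3 := by
    rw [Real.sqrt_eq_rpow, ← Real.rpow_natCast, ← Real.rpow_mul hτ.le]
    norm_num
  rw [e, ht]
  refine ((hd.neg.mul ((stdGaussPdf_hasDerivAt _).comp x hd)).div_const _).deriv.trans ?_
  simp [stdGaussPdf]
  field_simp
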